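/- Let τ be a partition with τ_1 ≤ n-k, and suppose σ is obtained from τ by adding an n-ribbon whose rightmost column is column i. Then σ exists if and only if the straightening of the sequence obtained from the conjugate τ' by increasing its i-th entry by n is a signed partition, in which case ε(σ/τ)·σ' = (-1)^{n-k-1}·⟨τ' with i-th entry increased by n⟩ as signed partitions. -/

import Mathlib

open scoped Classical
open Relation

noncomputable section

/-- Formal power series in countably many variables `x_0, x_1, ...` over `ℚ`. -/
abbrev FPS := MvPowerSeries ℕ ℚ

/-- A partition, encoded as a weakly decreasing, eventually-zero function giving part sizes. -/
def IsPtn (p : ℕ → ℕ) : Prop := Antitone p ∧ ∃ N, p N = 0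

/-- The Young diagram (set of cells `(row, column)`, zero-indexed) of `p`. -/
def cells (p : ℕ → ℕ) : Set (ℕ × ℕ) := {c | c.2 < p c.1}

/-- The conjugate partition. -/
def conjPtn (p : ℕ → ℕ) : ℕ → ℕ := fun j => Nat.card {i : ℕ // j < p i}

/-- `p` fits in a `k × w` box: at most `k` parts, each of size at most `w`. -/
def FitsBox (p : ℕ → ℕ) (k w : ℕ) : Prop := p 0 ≤ w ∧ p k = 0

/-- Generating function counting fillings `T` of a set `S` of boxes satisfying a predicate `Ok`,
weighted by content: the coefficient of `∏ x_v^{e v}` is the number of admissible fillings with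
exactly `e v` boxes of `S` labelled `v`. -/
def tabSeries {X : Type} (S : Set X) (Ok : (X → ℕ) → Prop) : FPS :=
  fun e => (Nat.card {T : X → ℕ //
    Ok T ∧ (∀ x, x ∉ S → T x = 0) ∧ ∀ v, Nat.card {x : X // x ∈ S ∧ T x = v} = e v} : ℚ)

/-- Semistandardness for fillings of a set of cells in `ℕ × ℕ`:
weakly increasing along rows, strictly increasing down columns. -/
def RowColOk (S : Set (ℕ × ℕ)) (T : ℕ × ℕ → ℕ) : Prop :=
  (∀ r c, (r, c) ∈ S → (r, c+1) ∈ S → T (r, c) ≤ T (r, c+1)) ∧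
  (∀ r c, (r, c) ∈ S → (r+1, c) ∈ S → T (r, c) < T (r+1, c))

/-- The skew Schur function `s_{lam/mu}` as the generating function of semistandard skew tableaux. -/
def skewSchur (lam mu : ℕ → ℕ) : FPS :=
  tabSeries (cells lam \ cells mu) (RowColOk (cells lam \ cells mu))

/-- The Schur function `s_lam`. -/
def schur (lam : ℕ → ℕ) : FPS := skewSchur lam (fun _ => 0)

/-- A symmetric function is Schur-positive if it is a non-negative linear combination of
Schur functions. -/
def IsSchurPos (f : FPS) : Prop :=
  ∃ (S : Finset (ℕ → ℕ)) (c : (ℕ → ℕ) → ℚ),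
    (∀ p ∈ S, IsPtn p) ∧ (∀ p ∈ S, 0 ≤ c p) ∧ f = ∑ p ∈ S, c p • schur p

/-- Edgewise adjacency in `ℕ × ℕ`. -/
def adjN (a b : ℕ × ℕ) : Prop :=
  b = (a.1 + 1, a.2) ∨ a = (b.1 + 1, b.2) ∨ b = (a.1, a.2 + 1) ∨ a = (b.1, b.2 + 1)

/-- A ribbon: a nonempty edgewise connected set of cells with no `2 × 2` block. -/
def IsRibbon (S : Set (ℕ × ℕ)) : Prop :=
  S.Nonempty ∧
  (∀ a b, a ∈ S → b ∈ S → Relation.ReflTransGen (fun p q => q ∈ S ∧ adjN p q) a b) ∧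
  ¬ ∃ a : ℕ × ℕ, a ∈ S ∧ (a.1 + 1, a.2) ∈ S ∧ (a.1, a.2 + 1) ∈ S ∧ (a.1 + 1, a.2 + 1) ∈ S

/-- `sigma` is obtained from `tau` by adding one `n`-ribbon. -/
def IsRibbonAdd (n : ℕ) (tau sigma : ℕ → ℕ) : Prop :=
  (∀ i, tau i ≤ sigma i) ∧ IsPtn sigma ∧
  Nat.card ↥(cells sigma \ cells tau) = n ∧ IsRibbon (cells sigma \ cells tau)

/-- The width (number of non-empty columns) of the skew shape `sigma/tau`. -/
def ribbonWidth (tau sigma : ℕ → ℕ) : ℕ :=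
  Nat.card {c : ℕ // ∃ r, (r, c) ∈ cells sigma \ cells tau}

/-- `tau` is obtained from `lam` by adding `d` `n`-ribbons. -/
def AddsRibbons (n d : ℕ) (lam tau : ℕ → ℕ) : Prop :=
  ∃ f : ℕ → ℕ → ℕ, f 0 = lam ∧ f d = tau ∧ ∀ i < d, IsRibbonAdd n (f i) (f (i + 1))

/-- The sign `ε(tau/lam) = (-1)^{∑ (n-k-width)}` over any chain of `d` `n`-ribbon additions
from `lam` to `tau` (the value is independent of the chain). -/
def epsSign (n k d : ℕ) (lam tau : ℕ → ℕ) : ℚ :=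
  if h : ∃ f : ℕ → ℕ → ℕ, f 0 = lam ∧ f d = tau ∧ ∀ i < d, IsRibbonAdd n (f i) (f (i + 1)) then
    (-1 : ℚ) ^ (∑ i ∈ Finset.range d, (n - k - ribbonWidth (h.choose i) (h.choose (i + 1))))
  else 0

/-- One signed adjacent transposition on signed integer sequences:
`(α_1,...,α_m) ∼ -(α_1,...,α_{i-1}, α_{i+1}-1, α_i+1, α_{i+2},...,α_m)`. -/
def swapStep (m : ℕ) (x y : ℤ × (Fin m → ℤ)) : Prop :=
  ∃ i j : Fin m, (j : ℕ) = (i : ℕ) + 1 ∧ y.1 = -x.1 ∧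
    y.2 = Function.update (Function.update x.2 i (x.2 j - 1)) j (x.2 i + 1)

/-- Equivalence of signed integer sequences. -/
def SEquiv (m : ℕ) : ℤ × (Fin m → ℤ) → ℤ × (Fin m → ℤ) → Prop :=
  Relation.EqvGen (swapStep m)

/-- The staircase-normal condition `β_1 - 1 ≥ β_2 - 2 ≥ ... ≥ β_m - m`. -/
def Staircase {m : ℕ} (β : Fin m → ℤ) : Prop :=
  ∀ i j : Fin m, (j : ℕ) = (i : ℕ) + 1 → β j - ((j : ℕ) : ℤ) ≤ β i - ((i : ℕ) : ℤ)

/-- `sigma` is obtained from `tau` by adding one `n`-ribbon whose rightmost column is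
column `i` (0-indexed). -/
def IsRibbonAddAt (n : ℕ) (tau sigma : ℕ → ℕ) (i : ℕ) : Prop :=
  IsRibbonAdd n tau sigma ∧ (∃ r, (r, i) ∈ cells sigma \ cells tau) ∧
  ∀ r c, (r, c) ∈ cells sigma \ cells tau → c ≤ i

theorem ptn_conj {p : ℕ → ℕ} (hp : IsPtn p) (r c : ℕ) : r < conjPtn p c ↔ c < p r := by
  obtain ⟨ha, N, hN⟩ := hp
  have hex : ∃ M, ¬ c < p M := ⟨N, by omega⟩
  have hspec : ¬ c < p (Nat.find hex) := Nat.find_spec hex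
  have key : ∀ x, c < p x ↔ x < Nat.find hex := by
    intro x
    constructor
    · intro h
      by_contra hx
      have := ha (not_lt.mp hx)
      omega
    · intro h
      have := Nat.find_min hex h
      tauto
  have hc : conjPtn p c = Nat.find hex := by
    unfold conjPtn
    have : {x : ℕ | c < p x} = ↑(Finset.range (Nat.find hex)) := by
      ext x; simp [key x]
    have h2 : Nat.card {x : ℕ // c < p x} = Set.ncard {x : ℕ | c < p x} := rfl
    rw [h2, this, Set.ncard_coe_finset, Finset.card_range]
  rw [hc, key]

theorem conj_ptn {p : ℕ → ℕ} (hp : IsPtn p) : IsPtn (conjPtn p) := by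
  constructor
  · intro a b hab
    by_contra h
    have h1 := (ptn_conj hp (conjPtn p a) b).1 (by omega)
    have h2 := (ptn_conj hp (conjPtn p a) a).2 (by omega)
    omega
  · refine ⟨p 0, ?_⟩
    by_contra h
    have := (ptn_conj hp 0 (p 0)).1 (by omega)
    omega

theorem conj_conj {p : ℕ → ℕ} (hp : IsPtn p) : conjPtn (conjPtn p) = p := by
  funext x
  have : ∀ y, y < conjPtn (conjPtn p) x ↔ y < p x := by
    intro y
    rw [ptn_conj (conj_ptn hp), ptn_conj hp]
  have h1 := this (p x)
  have h2 := this (conjPtn (conjPtn p) x)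
  omega

/-- The skew shape described by column heights. -/
def colSet (t s : ℕ → ℕ) : Set (ℕ × ℕ) := {x | t x.2 ≤ x.1 ∧ x.1 < s x.2}

theorem skew_eq {p q : ℕ → ℕ} (hp : IsPtn p) (hq : IsPtn q) :
    cells q \ cells p = colSet (conjPtn p) (conjPtn q) := by
  ext ⟨r, c⟩
  have h1 := ptn_conj hp r c
  have h2 := ptn_conj hq r c
  simp only [cells, colSet, Set.mem_sdiff, Set.mem_ofPred_eq]
  rw [← h1, ← h2]
  omega

/-- Column shape of a ribbon in columns `l, ..., i`. -/
structure RShape (t s : ℕ → ℕ) (l i : ℕ) : Prop where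
  le : l ≤ i
  lo : ∀ c, c < l → s c = t c
  hi : ∀ c, i < c → s c = t c
  mid : ∀ c, l ≤ c → c < i → s (c + 1) = t c + 1
  ne : t l < s l

theorem RShape.nonempty_iff {t s : ℕ → ℕ} {l i : ℕ} (h : RShape t s l i) (ht : Antitone t)
    (c : ℕ) : t c < s c ↔ l ≤ c ∧ c ≤ i := by
  constructor
  · intro hc
    by_contra hcon
    have h1 := h.lo c
    have h2 := h.hi c
    by_cases hl : c < l
    · have := h1 hl; omega
    · have := h2 (by omega); omega
  · rintro ⟨h1, h2⟩
    rcases Nat.eq_or_lt_of_le h1 with rfl | hlt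
    · exact h.ne
    · obtain ⟨d, rfl⟩ : ∃ d, c = d + 1 := ⟨c - 1, by omega⟩
      have := h.mid d (by omega) (by omega)
      have := ht (Nat.le_succ d)
      simp only [Nat.succ_eq_add_one] at this
      omega

theorem RShape.width {t s : ℕ → ℕ} {l i : ℕ} (h : RShape t s l i) (ht : Antitone t) :
    Nat.card {c : ℕ // ∃ r, (r, c) ∈ colSet t s} = i - l + 1 := by
  have : {c : ℕ | ∃ r, (r, c) ∈ colSet t s} = ↑(Finset.Icc l i) := by
    ext c
    simp only [colSet, Set.mem_ofPred_eq, Finset.coe_Icc, Set.mem_Icc]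
    rw [← h.nonempty_iff ht c]
    exact ⟨fun ⟨r, h1, h2⟩ => by omega, fun hc => ⟨t c, le_rfl, hc⟩⟩
  have h2 : Nat.card {c : ℕ // ∃ r, (r, c) ∈ colSet t s}
      = Set.ncard {c : ℕ | ∃ r, (r, c) ∈ colSet t s} := rfl
  have := h.le
  rw [h2, ‹{c : ℕ | ∃ r, (r, c) ∈ colSet t s} = _›, Set.ncard_coe_finset, Nat.card_Icc]
  omega

theorem RShape.sum {t s : ℕ → ℕ} {l i : ℕ} (h : RShape t s l i) (ht : Antitone t) :
    s l + (i - l) = t i + ∑ c ∈ Finset.Icc l i, (s c - t c) := by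
  have key : ∀ d, l + d ≤ i →
      s l + d = t (l + d) + ∑ c ∈ Finset.Icc l (l + d), (s c - t c) := by
    intro d
    induction d with
    | zero => intro _; have := h.ne; simp; omega
    | succ d ih =>
      intro hd
      have h1 := ih (by omega)
      have h2 := h.mid (l + d) (by omega) (by omega)
      have h3 := (h.nonempty_iff ht (l + d + 1)).2 ⟨by omega, by omega⟩
      rw [← add_assoc, ← add_assoc, Finset.sum_Icc_succ_top (by omega)]
      omega
  have h0 := h.le
  have := key (i - l) (by omega)
  rwa [show l + (i - l) = i by omega] at this

theorem RShape.card {t s : ℕ → ℕ} {l i : ℕ} (h : RShape t s l i) (ht : Antitone t) :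
    s l + (i - l) = t i + Nat.card ↥(colSet t s) := by
  rw [h.sum ht]
  congr 1
  have : colSet t s = ↑(((Finset.Icc l i).sigma (fun c => Finset.Ico (t c) (s c))).image
      (fun x => (x.2, x.1))) := by
    ext ⟨r, c⟩
    have := h.nonempty_iff ht c
    simp only [colSet, Set.mem_ofPred_eq, Finset.coe_image, Set.mem_image, Finset.mem_coe,
      Finset.mem_sigma, Finset.mem_Icc, Finset.mem_Ico, Prod.mk.injEq]
    constructor
    · rintro ⟨h1, h2⟩
      exact ⟨⟨c, r⟩, ⟨this.1 (by omega), h1, h2⟩, rfl, rfl⟩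
    · rintro ⟨⟨c', r'⟩, ⟨_, h1⟩, rfl, rfl⟩
      exact h1
  rw [Nat.card_coe_set_eq, this, Set.ncard_coe_finset, Finset.card_image_of_injective,
    Finset.card_sigma]
  · simp
  · rintro ⟨a, b⟩ ⟨c, d⟩ hx
    simp only [Prod.mk.injEq] at hx
    obtain ⟨rfl, rfl⟩ := hx
    rfl

theorem shape_of_ribbon {t s : ℕ → ℕ} {i : ℕ} (ht : Antitone t) (hs : Antitone s)
    (hts : ∀ c, t c ≤ s c) (hr : IsRibbon (colSet t s)) (hi : ∃ r, (r, i) ∈ colSet t s)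
    (hmax : ∀ r c, (r, c) ∈ colSet t s → c ≤ i) : ∃ l, RShape t s l i := by
  obtain ⟨_, hconn, hsq⟩ := hr
  have hi' : t i < s i := by
    obtain ⟨r, h1, h2⟩ := hi
    simp only at h1 h2
    omega
  have hex : ∃ l, t l < s l := ⟨i, hi'⟩
  have hl := Nat.find_spec hex
  have hmin : ∀ c, c < Nat.find hex → ¬ t c < s c := fun c hc => Nat.find_min hex hc
  have hle : Nat.find hex ≤ i := Nat.find_min' hex hi'
  generalize Nat.find hex = l at hl hmin hle
  refine ⟨l, hle, ?_, ?_, ?_, hl⟩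
  · intro c hc
    have := hmin c hc
    have := hts c
    omega
  · intro c hc
    have := hts c
    by_contra hne
    have := hmax (t c) c ⟨le_rfl, by simp only; omega⟩
    omega
  · intro c hlc hci
    have htc : t (c + 1) ≤ t c := ht (Nat.le_succ c)
    have hsc : s (c + 1) ≤ s c := hs (Nat.le_succ c)
    have h1 : t c < s (c + 1) := by
      by_contra hcon
      have hp := hconn (t i, i) (t l, l) ⟨le_rfl, hi'⟩ ⟨le_rfl, hl⟩
      have key : ∀ q, Relation.ReflTransGen
          (fun p q => q ∈ colSet t s ∧ adjN p q) (t i, i) q → q ∈ colSet t s ∧ c < q.2 := by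
        intro q hq
        induction hq with
        | refl => exact ⟨⟨le_rfl, hi'⟩, hci⟩
        | @tail a b _ hab ih =>
          obtain ⟨hb, hadj⟩ := hab
          obtain ⟨ha, hca⟩ := ih
          refine ⟨hb, ?_⟩
          obtain ⟨a1, a2⟩ := a
          obtain ⟨b1, b2⟩ := b
          simp only [adjN, colSet, Set.mem_ofPred_eq, Prod.mk.injEq] at *
          by_contra hb2
          rcases hadj with h | h | h | h
          · omega
          · omega
          · omega
          · have e1 : b2 = c := by omega
            have e2 : a2 = c + 1 := by omega
            subst e1 e2
            omega
      have := (key _ hp).2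
      simp only at this
      omega
    by_contra hne
    apply hsq
    refine ⟨(t c, c), ?_⟩
    simp only [colSet, Set.mem_ofPred_eq]
    omega

theorem ribbon_of_shape {t s : ℕ → ℕ} {l i : ℕ} (ht : Antitone t) (h : RShape t s l i) :
    IsRibbon (colSet t s) := by
  have hii := (h.nonempty_iff ht i).2 ⟨h.le, le_rfl⟩
  refine ⟨⟨(t i, i), le_rfl, hii⟩, ?_, ?_⟩
  · set R : ℕ × ℕ → ℕ × ℕ → Prop :=
      fun p q => p ∈ colSet t s ∧ q ∈ colSet t s ∧ adjN p q with hR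
    have hsymm : Std.Symm R := by
      refine ⟨fun p q hpq => ?_⟩
      obtain ⟨h1, h2, h3⟩ := hpq
      refine ⟨h2, h1, ?_⟩
      unfold adjN at *
      tauto
    have vert : ∀ d c, t c + d < s c → Relation.ReflTransGen R (t c + d, c) (t c, c) := by
      intro d
      induction d with
      | zero => intro c _; exact Relation.ReflTransGen.refl
      | succ d ih =>
        intro c hc
        refine Relation.ReflTransGen.head ?_ (ih c (by omega))
        refine ⟨⟨by simp only; omega, hc⟩, ⟨by simp only; omega, by simp only; omega⟩, ?_⟩
        right; left; rfl
    have horiz : ∀ d c, c + d = i → l ≤ c → Relation.ReflTransGen R (t c, c) (t i, i) := by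
      intro d
      induction d with
      | zero =>
        intro c hc _
        have : c = i := by omega
        subst this
        exact Relation.ReflTransGen.refl
      | succ d ih =>
        intro c hc hlc
        have h1 := h.mid c hlc (by omega)
        have h2 : t (c + 1) ≤ t c := ht (Nat.le_succ c)
        have h3 := (h.nonempty_iff ht c).2 ⟨hlc, by omega⟩
        refine Relation.ReflTransGen.head (b := (t c, c + 1)) ?_ ?_
        · refine ⟨⟨le_rfl, h3⟩, ⟨h2, by simp only; omega⟩, ?_⟩
          right; right; left; rfl
        · refine Relation.ReflTransGen.trans ?_ (ih (c + 1) (by omega) (by omega))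
          have := vert (t c - t (c + 1)) (c + 1) (by omega)
          rwa [show t (c + 1) + (t c - t (c + 1)) = t c by omega] at this
    have all : ∀ a, a ∈ colSet t s → Relation.ReflTransGen R a (t i, i) := by
      rintro ⟨r, c⟩ ⟨h1, h2⟩
      simp only at h1 h2
      have hc := (h.nonempty_iff ht c).1 (by omega)
      have hv := vert (r - t c) c (by omega)
      rw [show t c + (r - t c) = r by omega] at hv
      exact hv.trans (horiz (i - c) c (by omega) hc.1)
    intro a b ha hb
    have hab : Relation.ReflTransGen R a b :=
      (all a ha).trans ((Relation.ReflTransGen.stdSymm (r := R)).symm _ _ (all b hb))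
    exact Relation.ReflTransGen.mono (fun p q hpq => ⟨hpq.2.1, hpq.2.2⟩) _ _ hab
  · rintro ⟨⟨r, c⟩, h1, h2, h3, h4⟩
    simp only [colSet, Set.mem_ofPred_eq] at *
    have a1 := (h.nonempty_iff ht c).1 (by omega)
    have a2 := (h.nonempty_iff ht (c + 1)).1 (by omega)
    have := h.mid c a1.1 (by omega)
    omega

/-- Sequence with the entry `i` (raised by `n`) moved to position `l`. -/
def movedSeq (m n : ℕ) (t : ℕ → ℕ) (i l : ℕ) : Fin m → ℤ := fun j =>
  if (j : ℕ) < l then (t j : ℤ)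
  else if (j : ℕ) = l then (t i : ℤ) + n - ((i : ℤ) - l)
  else if (j : ℕ) ≤ i then (t ((j : ℕ) - 1) : ℤ) + 1
  else (t j : ℤ)

theorem moved_equiv (m n : ℕ) (t : ℕ → ℕ) (i : Fin m) :
    ∀ d l : ℕ, l + d = i →
      SEquiv m (1, fun j => (t j : ℤ) + if j = i then (n : ℤ) else 0)
        ((-1) ^ d, movedSeq m n t i l) := by
  intro d
  induction d with
  | zero =>
    intro l hl
    have : (fun j : Fin m => (t j : ℤ) + if j = i then (n : ℤ) else 0) = movedSeq m n t i l := by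
      funext j
      unfold movedSeq
      have hl' : l = (i : ℕ) := by omega
      subst hl'
      by_cases hj : j = i
      · subst hj; simp
      · have hj' : (j : ℕ) ≠ i := fun h => hj (Fin.ext h)
        by_cases hlt : (j : ℕ) < i
        · simp [hj, hlt]
        · have : ¬ (j : ℕ) ≤ i := by omega
          simp [hj, hj', hlt, this]
    rw [pow_zero, this]
    exact Relation.EqvGen.refl _
  | succ d ih =>
    intro l hl
    refine Relation.EqvGen.trans _ _ _ (ih (l + 1) (by omega)) (Relation.EqvGen.rel _ _ ?_)
    have := i.2
    refine ⟨⟨l, by omega⟩, ⟨l + 1, by omega⟩, rfl, ?_, ?_⟩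
    · simp [pow_succ]
    · funext j
      simp only [Function.update_apply, Fin.ext_iff, movedSeq]
      by_cases h1 : (j : ℕ) = l + 1
      · have : l + 1 ≤ (i : ℕ) := by omega
        simp [h1, this]
      · by_cases h2 : (j : ℕ) = l
        · simp [h2]; ring
        · by_cases h3 : (j : ℕ) < l
          · simp [h1, h2, h3, show (j : ℕ) < l + 1 by omega]
          · simp [h1, h2, h3, show ¬ (j : ℕ) < l + 1 by omega]

theorem moved_of_shape {m n : ℕ} {t s : ℕ → ℕ} {l i : ℕ} (h : RShape t s l i)
    (hn : s l + (i - l) = t i + n) (j : Fin m) : movedSeq m n t i l j = (s j : ℤ) := by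
  have := h.le
  unfold movedSeq
  split_ifs with h1 h2 h3
  · rw [h.lo _ h1]
  · rw [h2]; omega
  · have := h.mid ((j : ℕ) - 1) (by omega) (by omega)
    rw [show (j : ℕ) - 1 + 1 = j by omega] at this
    omega
  · rw [h.hi _ (by omega)]

theorem sequiv_perm {m : ℕ} {x y : ℤ × (Fin m → ℤ)} (h : SEquiv m x y) :
    ∃ π : Equiv.Perm (Fin m), (∀ j, y.2 j - (j : ℕ) = x.2 (π j) - ((π j : Fin m) : ℕ)) ∧
      y.1 = ((Equiv.Perm.sign π : ℤˣ) : ℤ) * x.1 := by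
  induction h with
  | rel x y h =>
    obtain ⟨i, j, hij, h1, h2⟩ := h
    have hne : i ≠ j := by
      rintro rfl; omega
    refine ⟨Equiv.swap i j, ?_, ?_⟩
    · intro c
      rw [h2]
      by_cases hc : c = j
      · subst hc
        simp [hij]
      · by_cases hc' : c = i
        · subst hc'
          simp [hij, hc]; ring
        · simp [hc, hc', Equiv.swap_apply_of_ne_of_ne hc' hc]
    · rw [Equiv.Perm.sign_swap hne, h1]; simp
  | refl x => exact ⟨1, by simp, by simp⟩
  | symm x y _ ih =>
    obtain ⟨π, h1, h2⟩ := ih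
    refine ⟨π⁻¹, ?_, ?_⟩
    · intro j
      rw [h1]; simp
    · rw [h2, Equiv.Perm.sign_inv, ← mul_assoc, ← Units.val_mul, Int.units_mul_self]; simp
  | trans x y z _ _ ih1 ih2 =>
    obtain ⟨π, h1, h2⟩ := ih1
    obtain ⟨ρ, h3, h4⟩ := ih2
    refine ⟨π * ρ, ?_, ?_⟩
    · intro j
      rw [h3, h1]; simp
    · rw [h4, h2, Equiv.Perm.sign_mul, Units.val_mul]; ring

theorem staircase_antitone {m : ℕ} {β : Fin m → ℤ} (h : Staircase β) :
    Antitone (fun j : Fin m => β j - ((j : ℕ) : ℤ)) := by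
  have key : ∀ d : ℕ, ∀ a b : Fin m, (b : ℕ) = a + d →
      β b - ((b : ℕ) : ℤ) ≤ β a - ((a : ℕ) : ℤ) := by
    intro d
    induction d with
    | zero =>
      intro a b hab
      have : a = b := Fin.ext (by omega)
      subst this; exact le_rfl
    | succ d ih =>
      intro a b hab
      have hb := b.2
      have h1 := ih a ⟨a + d, by omega⟩ rfl
      have h2 := h ⟨a + d, by omega⟩ b (by simp only; omega)
      exact h2.trans h1
  intro a b hab
  exact key (b - a : ℕ) a b (by have : (a : ℕ) ≤ b := hab; omega)

theorem antitone_strict {m : ℕ} {β : Fin m → ℤ} (h : Antitone β) :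
    StrictAnti (fun j : Fin m => β j - ((j : ℕ) : ℤ)) := by
  intro a b hab
  have h1 := h hab.le
  have h2 : (a : ℕ) < b := hab
  simp only
  omega

theorem sequiv_unique {m : ℕ} {s s' : ℤ} {β γ : Fin m → ℤ} (h : SEquiv m (s, β) (s', γ))
    (hβ : Antitone β) (hγ : Staircase γ) : s' = s ∧ γ = β := by
  obtain ⟨π, h1, h2⟩ := sequiv_perm h
  simp only at h1 h2
  have sβ := antitone_strict hβ
  have aγ := staircase_antitone hγ
  have hπ : StrictMono π := by
    intro a b hab
    by_contra hcon
    have hne : π b ≠ π a := fun he => hab.ne' (π.injective he)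
    have hlt : π b < π a := lt_of_le_of_ne (not_lt.mp hcon) hne
    have e1 := sβ hlt
    have e2 := aγ hab.le
    simp only at e1 e2
    rw [h1, h1] at e2
    omega
  have hone : π = 1 := by
    apply Equiv.ext
    intro j
    have : (π : Fin m → Fin m) = id := by
      rw [← StrictMono.range_inj hπ strictMono_id]
      simp
    rw [this]; rfl
  subst hone
  refine ⟨by simpa using h2, ?_⟩
  funext j
  have := h1 j
  simpa using this

theorem shape_of_add {n : ℕ} {tau sigma : ℕ → ℕ} {i : ℕ} (htau : IsPtn tau)
    (h : IsRibbonAddAt n tau sigma i) :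
    ∃ l, RShape (conjPtn tau) (conjPtn sigma) l i ∧
      conjPtn sigma l + (i - l) = conjPtn tau i + n ∧
      ribbonWidth tau sigma = i - l + 1 := by
  obtain ⟨⟨hle, hsig, hcard, hrib⟩, hi, hmax⟩ := h
  unfold ribbonWidth
  rw [skew_eq htau hsig] at *
  have ht := (conj_ptn htau).1
  have hs := (conj_ptn hsig).1
  obtain ⟨l, hl⟩ := shape_of_ribbon ht hs (by
    intro c
    by_contra hcon
    have h1 := (ptn_conj htau (conjPtn sigma c) c).1 (by omega)
    have h2 := (ptn_conj hsig (conjPtn sigma c) c).2 (lt_of_lt_of_le h1 (hle _))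
    omega) hrib hi hmax
  refine ⟨l, hl, ?_, hl.width ht⟩
  rw [hl.card ht, hcard]

theorem add_of_shape {n : ℕ} {tau s : ℕ → ℕ} {l i : ℕ} (htau : IsPtn tau) (hs : IsPtn s)
    (hsh : RShape (conjPtn tau) s l i) (hn : s l + (i - l) = conjPtn tau i + n) :
    IsRibbonAddAt n tau (conjPtn s) i := by
  have hsig := conj_ptn hs
  have ht := (conj_ptn htau).1
  have hcc := conj_conj hs
  have hii := (hsh.nonempty_iff ht i).2 ⟨hsh.le, le_rfl⟩
  unfold IsRibbonAddAt IsRibbonAdd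
  rw [skew_eq htau hsig, hcc]
  refine ⟨⟨?_, hsig, ?_, ribbon_of_shape ht hsh⟩, ⟨conjPtn tau i, le_rfl, hii⟩, ?_⟩
  · intro r
    by_contra hcon
    have h1 := (ptn_conj htau r (conjPtn s r)).2 (by omega)
    have h2 : conjPtn tau (conjPtn s r) ≤ s (conjPtn s r) := by
      have h3 := hsh.nonempty_iff ht (conjPtn s r)
      by_contra h4
      have h5 : ¬ (l ≤ conjPtn s r ∧ conjPtn s r ≤ i) := by
        rw [← h3]; omega
      by_cases h6 : conjPtn s r < l
      · have := hsh.lo _ h6; omega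
      · have := hsh.hi (conjPtn s r) (by omega); omega
    have := (ptn_conj hs (conjPtn s r) r).2 (by omega)
    omega
  · have := hsh.card ht
    omega
  · rintro r c ⟨h1, h2⟩
    simp only at h1 h2
    exact ((hsh.nonempty_iff ht c).1 (by omega)).2

/-- Column heights after adding the ribbon. -/
def newCols (n : ℕ) (t : ℕ → ℕ) (i l : ℕ) : ℕ → ℕ := fun j =>
  if j < l then t j
  else if j = l then t i + n - (i - l)
  else if j ≤ i then t (j - 1) + 1
  else t j

theorem exists_shape {n i : ℕ} {t : ℕ → ℕ} (ht : IsPtn t) (hin : i < n)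
    (hne : ∀ j, j < i → t j + i ≠ t i + n + j) :
    ∃ s l, IsPtn s ∧ RShape t s l i ∧ s l + (i - l) = t i + n := by
  have hex : ∃ l, t l + i < t i + n + l := ⟨i, by omega⟩
  have hl := Nat.find_spec hex
  have hmin : ∀ c, c < Nat.find hex → ¬ t c + i < t i + n + c := fun c hc => Nat.find_min hex hc
  have hle : Nat.find hex ≤ i := Nat.find_min' hex (by omega)
  generalize Nat.find hex = l at hl hmin hle
  have ha : ∀ c, t (c + 1) ≤ t c := fun c => ht.1 (Nat.le_succ c)
  have hsh : RShape t (newCols n t i l) l i := by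
    refine ⟨hle, ?_, ?_, ?_, ?_⟩
    · intro c hc; simp [newCols, hc]
    · intro c hc
      simp [newCols, show ¬ c < l by omega, show c ≠ l by omega, show ¬ c ≤ i by omega]
    · intro c h1 h2
      simp [newCols, show ¬ c + 1 < l by omega, show c + 1 ≠ l by omega, show c + 1 ≤ i by omega]
    · simp [newCols]; omega
  have hsl : newCols n t i l l = t i + n - (i - l) := by simp [newCols]
  refine ⟨newCols n t i l, l, ⟨?_, ?_⟩, hsh, ?_⟩
  · apply antitone_nat_of_succ_le
    intro c
    have hac := ha c
    rcases lt_trichotomy (c + 1) l with h | h | h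
    · rw [hsh.lo _ h, hsh.lo _ (by omega)]; exact hac
    · have h1 := hmin c (by omega)
      have h2 := hne c (by omega)
      rw [hsh.lo c (by omega), h, hsl]
      omega
    · by_cases h3 : c + 1 ≤ i
      · rw [hsh.mid c (by omega) (by omega)]
        exact (hsh.nonempty_iff ht.1 c).2 ⟨by omega, by omega⟩
      · rw [hsh.hi (c + 1) (by omega)]
        by_cases h4 : c ≤ i
        · have := (hsh.nonempty_iff ht.1 c).2 ⟨by omega, by omega⟩
          omega
        · rw [hsh.hi c (by omega)]; exact hac
  · obtain ⟨N, hN⟩ := ht.2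
    refine ⟨N + i + 1, ?_⟩
    rw [hsh.hi _ (by omega)]
    have : t (N + i + 1) ≤ t N := ht.1 (by omega)
    omega
  · rw [hsl]; omega

/-- Adding an `n`-ribbon to `tau` (with `tau_1 ≤ n-k`) with rightmost column `i` is possible
iff the straightening of `τ' + n·e_i` is a signed partition, in which case
`ε(σ/τ)·σ' = (-1)^{n-k-1}·⟨τ' + n·e_i⟩` as signed sequences. -/
theorem stmt12 (n k : ℕ) (hk : 0 < k) (hkn : k < n) (tau : ℕ → ℕ) (htau : IsPtn tau)
    (h1 : tau 0 ≤ n - k) (i : Fin (n - k)) :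
    ((∃ sigma, IsRibbonAddAt n tau sigma i) ↔
      ∃ (s : ℤ) (β : Fin (n - k) → ℤ),
        SEquiv (n - k)
          (1, fun j => (conjPtn tau j : ℤ) + if j = i then (n : ℤ) else 0) (s, β) ∧
        Staircase β ∧ Antitone β ∧ ∀ j, 0 ≤ β j) ∧
    ∀ sigma, IsRibbonAddAt n tau sigma i →
      ∀ (s : ℤ) (β : Fin (n - k) → ℤ),
        SEquiv (n - k)
          (1, fun j => (conjPtn tau j : ℤ) + if j = i then (n : ℤ) else 0) (s, β) →
        Staircase β →
        (-1 : ℤ) ^ (n - k - 1) * s = (-1 : ℤ) ^ (n - k - ribbonWidth tau sigma) ∧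
        ∀ j : Fin (n - k), β j = (conjPtn sigma j : ℤ) := by
  
  have ht := conj_ptn htau
  have hi := i.2
  have fwd : ∀ sigma, IsRibbonAddAt n tau sigma i → ∃ l : ℕ, l ≤ (i : ℕ) ∧
      ribbonWidth tau sigma = i - l + 1 ∧
      SEquiv (n - k) (1, fun j => (conjPtn tau j : ℤ) + if j = i then (n : ℤ) else 0)
        ((-1) ^ ((i : ℕ) - l), fun j => (conjPtn sigma j : ℤ)) ∧
      Antitone (fun j : Fin (n - k) => (conjPtn sigma j : ℤ)) := by
    intro sigma hs
    obtain ⟨l, hl, hn, hw⟩ := shape_of_add htau hs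
    have hle := hl.le
    refine ⟨l, hle, hw, ?_, ?_⟩
    · have h := moved_equiv (n - k) n (conjPtn tau) i (i - l) l (by omega)
      have e : movedSeq (n - k) n (conjPtn tau) i l =
          fun j : Fin (n - k) => (conjPtn sigma j : ℤ) := by
        funext j
        exact moved_of_shape hl hn j
      rwa [e] at h
    · intro a b hab
      have := (conj_ptn hs.1.2.1).1 (show (a : ℕ) ≤ b from hab)
      simp only
      omega
  refine ⟨⟨?_, ?_⟩, ?_⟩
  · rintro ⟨sigma, hs⟩
    obtain ⟨l, _, _, hE, hA⟩ := fwd sigma hs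
    refine ⟨_, _, hE, ?_, hA, fun j => by positivity⟩
    intro a b hab
    exact (antitone_strict hA).antitone (show (a : ℕ) ≤ b by omega)
  · rintro ⟨s, β, hE, _, hA, _⟩
    obtain ⟨π, h1, _⟩ := sequiv_perm (Relation.EqvGen.symm _ _ hE)
    simp only at h1
    have hinj := (antitone_strict hA).injective
    obtain ⟨s', l, hs', hsh, hn⟩ := exists_shape (n := n) (i := i) ht (by omega) (by
      intro j hj hcon
      have a1 := h1 i
      have a2 := h1 ⟨j, by omega⟩
      have hne : (⟨j, by omega⟩ : Fin (n - k)) ≠ i := by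
        intro h
        have := congrArg Fin.val h
        simp only at this
        omega
      simp only [if_true, if_neg hne] at a1 a2
      apply hne
      apply π.injective
      apply hinj
      simp only
      omega)
    exact ⟨_, add_of_shape htau hs' hsh hn⟩
  · intro sigma hs s β hE hS
    obtain ⟨l, hl, hw, hE', hA⟩ := fwd sigma hs
    obtain ⟨e1, e2⟩ := sequiv_unique
      (Relation.EqvGen.trans _ _ _ (Relation.EqvGen.symm _ _ hE') hE) hA hS
    refine ⟨?_, fun j => by rw [e2]⟩
    rw [e1, hw, show n - k - 1 = (n - k - (i - l + 1)) + (i - l) by omega, pow_add, mul_assoc,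
      ← mul_pow]
    simp
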